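/- Let K be an algebraically closed field of characteristic 2 and V a K-vector space of dimension 2m with symplectic basis x_1,y_1,...,x_m,y_m and form f, DV its divided power algebra with differential ∂ given by multiplication by ω = x_1y_1 + ... + x_my_m. Then H^{m+2}(DV) = ker ∂_{m+2} / Im ∂_m is an irreducible Sp(V)-module: it is nonzero and its only Sp(V)-invariant subspaces are 0 and the whole space. -/

import Mathlib

noncomputable section

open Finsupp TensorProduct

/-- The underlying space of the divided power algebra `DV` of a vector space `V` with basis
indexed by `ι`: the free `K`-module on the set of multi-indices, where a multi-index
`a : ι →₀ ℕ` corresponds to the basis monomial `∏ᵢ vᵢ^{(a i)}`. -/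
abbrev DPA (K ι : Type) [Field K] := (ι →₀ ℕ) →₀ K

/-- Total degree of a multi-index. -/
def deg {ι : Type} (a : ι →₀ ℕ) : ℕ := a.sum fun _ e => e

/-- The degree-`k` homogeneous component `D_k V` of the divided power algebra. -/
def Dsub (K ι : Type) [Field K] (k : ℕ) : Submodule K (DPA K ι) :=
  Submodule.span K {f | ∃ a : ι →₀ ℕ, deg a = k ∧ f = Finsupp.single a (1 : K)}

/-- The structure constant of the divided power algebra:
`(∏ᵢ vᵢ^{(a i)}) ⬝ (∏ᵢ vᵢ^{(b i)}) = (∏ᵢ C(a i + b i, a i)) • ∏ᵢ vᵢ^{(a i + b i)}`. -/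
def dpCoef {ι : Type} (a b : ι →₀ ℕ) : ℕ :=
  (a + b).prod fun i _ => Nat.choose (a i + b i) (a i)

/-- Multiplication of the divided power algebra, as a bilinear map. -/
def dpMul (K ι : Type) [Field K] : DPA K ι →ₗ[K] DPA K ι →ₗ[K] DPA K ι :=
  Finsupp.lsum K fun a => LinearMap.toSpanSingleton K _
    (Finsupp.lsum K fun b => LinearMap.toSpanSingleton K _
      ((dpCoef a b : K) • Finsupp.single (a + b) (1 : K)))

/-- Divided power `w^{(n)} ∈ D_n V` of a vector `w = ∑ᵢ wᵢ vᵢ ∈ V`; it is determined by the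
rules `(u+v)^{(a)} = ∑ u^{(i)} v^{(a-i)}` and `(t u)^{(a)} = tᵃ u^{(a)}`. -/
def dpow {K ι : Type} [Field K] [Fintype ι] [DecidableEq ι] (w : ι → K) (n : ℕ) : DPA K ι :=
  ∑ c ∈ Finset.univ.finsuppAntidiag n, Finsupp.single c (c.prod fun i e => w i ^ e)

/-- The image `∏ᵢ (g vᵢ)^{(a i)}` of the basis monomial `∏ᵢ vᵢ^{(a i)}` under the algebra
endomorphism of `DV` induced by the matrix `g`. -/
def actMon {K ι : Type} [Field K] [Fintype ι] [DecidableEq ι]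
    (g : Matrix ι ι K) (a : ι →₀ ℕ) : DPA K ι :=
  (a.support.toList.map fun i => dpow (fun j => g j i) (a i)).foldr
    (fun p q => dpMul K ι p q) (Finsupp.single 0 1)

/-- The algebra endomorphism of `DV` induced by the matrix `g` acting on `V` in the given
basis (for `g` invertible this is the induced algebra automorphism of `DV`). -/
def act {K ι : Type} [Field K] [Fintype ι] [DecidableEq ι] (g : Matrix ι ι K) :
    DPA K ι →ₗ[K] DPA K ι :=
  Finsupp.lsum K fun a => LinearMap.toSpanSingleton K _ (actMon g a)

/-- The entrywise square of a matrix (giving the Frobenius twist of a representation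
in characteristic 2). -/
def matSq {K ι : Type} [Field K] (g : Matrix ι ι K) : Matrix ι ι K :=
  fun i j => g i j * g i j

/-! Symplectic setting: `V` has dimension `2m` and symplectic basis `x_1,y_1,…,x_m,y_m`
indexed by `Fin m × Bool`, with `x_i = (i, false)` and `y_i = (i, true)`. -/

/-- The multi-index of the monomial `x_i y_i`. -/
def xyIdx (m : ℕ) (i : Fin m) : (Fin m × Bool) →₀ ℕ :=
  Finsupp.single (i, false) 1 + Finsupp.single (i, true) 1

/-- The element `ω = x_1 y_1 + ⋯ + x_m y_m ∈ D_2 V`. -/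
def omegaDP (K : Type) [Field K] (m : ℕ) : DPA K (Fin m × Bool) :=
  ∑ i : Fin m, Finsupp.single (xyIdx m i) (1 : K)

/-- The differential `∂` of the complex `DV`: multiplication by `ω`.  It restricts to
`∂_k : D_k V → D_{k+2} V`. -/
def del (K : Type) [Field K] (m : ℕ) :
    DPA K (Fin m × Bool) →ₗ[K] DPA K (Fin m × Bool) :=
  dpMul K (Fin m × Bool) (omegaDP K m)

/-- The matrix of the non-degenerate alternating bilinear form `f` with `f(x_i, y_j) = δᵢⱼ`,
`f(x_i, x_j) = f(y_i, y_j) = 0`. -/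
def Jmat (K : Type) [Field K] (m : ℕ) : Matrix (Fin m × Bool) (Fin m × Bool) K :=
  fun p q => if p.1 = q.1 ∧ p.2 ≠ q.2 then 1 else 0

/-- The condition that the matrix `g` belongs to the symplectic group `Sp(V)`:
`g` preserves the form `f`, i.e. `f(gu, gv) = f(u, v)` for all `u, v ∈ V`. -/
def IsSymplectic {K : Type} [Field K] {m : ℕ}
    (g : Matrix (Fin m × Bool) (Fin m × Bool) K) : Prop :=
  g.transpose * Jmat K m * g = Jmat K m

/-- The cocycles in degree `k`: `ker ∂_k = ker ∂ ∩ D_k V`. -/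
def Zmod (K : Type) [Field K] (m k : ℕ) : Submodule K (DPA K (Fin m × Bool)) :=
  LinearMap.ker (del K m) ⊓ Dsub K (Fin m × Bool) k

/-- The coboundaries in degree `k`: `Im ∂_{k-2} = ∂(D_{k-2} V)`.  (For `k = 0, 1`
truncated subtraction gives `∂(D_0 V) ⊆ D_2 V`, which meets `D_k V` only in `0`,
so no harm is done.) -/
def Bful (K : Type) [Field K] (m k : ℕ) : Submodule K (DPA K (Fin m × Bool)) :=
  Submodule.map (del K m) (Dsub K (Fin m × Bool) (k - 2))

/-- The cohomology `H^k(DV) = ker ∂_k / Im ∂_{k-2}` of the complex `DV`, realized as the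
image of `ker ∂_k` in `DV / Im ∂_{k-2}`. -/
abbrev Hcoh (K : Type) [Field K] (m k : ℕ) :=
  ↥(Submodule.map (Bful K m k).mkQ (Zmod K m k))

/-- The canonical projection `ker ∂_k → H^k(DV)`, sending a cocycle `z` to its
cohomology class `z + Im ∂_{k-2}`. -/
def toH (K : Type) [Field K] (m k : ℕ) : ↥(Zmod K m k) →ₗ[K] Hcoh K m k :=
  LinearMap.codRestrict _ ((Bful K m k).mkQ.comp (Zmod K m k).subtype)
    (fun z => Submodule.mem_map_of_mem z.2)


set_option linter.unusedSimpArgs false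
set_option linter.unusedSectionVars false
set_option linter.flexible false
/-! ## Multiplication -/

section general

variable {K ι : Type} [Field K]

theorem dpMul_single (a b : ι →₀ ℕ) (c d : K) :
    dpMul K ι (Finsupp.single a c) (Finsupp.single b d)
      = Finsupp.single (a + b) (c * d * (dpCoef a b : K)) := by
  simp only [dpMul, Finsupp.lsum_single, LinearMap.toSpanSingleton_apply, LinearMap.smul_apply,
    Finsupp.smul_single, smul_eq_mul, mul_one, mul_assoc]

theorem dpCoef_eq [Fintype ι] (a b : ι →₀ ℕ) :
    dpCoef a b = ∏ i, Nat.choose (a i + b i) (a i) := by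
  unfold dpCoef
  rw [Finsupp.prod]
  apply Finset.prod_subset (Finset.subset_univ _)
  intro i _ hi
  simp at hi
  simp [hi]

theorem choose_left_comm (p q r : ℕ) :
    Nat.choose (q + r) q * Nat.choose (p + (q + r)) p
      = Nat.choose (p + r) p * Nat.choose (q + (p + r)) q := by
  have h1 := Nat.add_choose_mul_factorial_mul_factorial q r
  have h2 := Nat.add_choose_mul_factorial_mul_factorial p (q + r)
  have h3 := Nat.add_choose_mul_factorial_mul_factorial p r
  have h4 := Nat.add_choose_mul_factorial_mul_factorial q (p + r)
  rw [← Nat.choose_symm_add] at h1 h2 h3 h4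
  have e : q + (p + r) = p + (q + r) := by omega
  rw [e] at h4 ⊢
  have hp : 0 < p.factorial * q.factorial * r.factorial := by positivity
  apply Nat.eq_of_mul_eq_mul_right hp
  calc _ = (p + (q + r)).factorial := by
        rw [← h2, ← h1]; ring
    _ = _ := by rw [← h4, ← h3]; ring

theorem dpMul_left_comm [Fintype ι] (p q r : DPA K ι) :
    dpMul K ι p (dpMul K ι q r) = dpMul K ι q (dpMul K ι p r) := by
  induction p using Finsupp.induction_linear with
  | zero => simp
  | add f g hf hg => simp [hf, hg]
  | single a c =>
  induction q using Finsupp.induction_linear with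
  | zero => simp
  | add f g hf hg => simp [hf, hg]
  | single b d =>
  induction r using Finsupp.induction_linear with
  | zero => simp
  | add f g hf hg => simp [hf, hg]
  | single e f =>
  simp only [dpMul_single]
  have h : dpCoef b e * dpCoef a (b + e) = dpCoef a e * dpCoef b (a + e) := by
    simp only [dpCoef_eq, ← Finset.prod_mul_distrib]
    apply Finset.prod_congr rfl
    intro i _
    exact choose_left_comm (a i) (b i) (e i)
  have h' : (dpCoef b e : K) * dpCoef a (b + e) = dpCoef a e * dpCoef b (a + e) := by
    exact_mod_cast congrArg (Nat.cast : ℕ → K) h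
  rw [add_left_comm]
  congr 1
  linear_combination c * d * f * h'

instance [Fintype ι] : LeftCommutative (fun p q : DPA K ι => dpMul K ι p q) :=
  ⟨dpMul_left_comm⟩

theorem dpCoef_disj [Fintype ι] (a b : ι →₀ ℕ) (h : ∀ i, a i = 0 ∨ b i = 0) :
    dpCoef a b = 1 := by
  rw [dpCoef_eq]
  apply Finset.prod_eq_one
  intro i _
  rcases h i with h | h <;> simp [h]

variable [Fintype ι] [DecidableEq ι]

theorem dpow_single (j : ι) (n : ℕ) :
    dpow (fun i => if i = j then (1 : K) else 0) n = Finsupp.single (Finsupp.single j n) 1 := by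
  unfold dpow
  rw [Finset.sum_eq_single (Finsupp.single j n)]
  · by_cases hn : n = 0
    · simp [hn]
    · simp
  · intro c hc hne
    rw [Finsupp.single_eq_zero]
    have : ∃ i, i ≠ j ∧ c i ≠ 0 := by
      by_contra hcon
      push Not at hcon
      apply hne
      have hs := (Finset.mem_finsuppAntidiag.1 hc).1
      rw [Finset.sum_eq_single j (fun b _ hb => hcon b hb) (by simp)] at hs
      ext i
      by_cases hi : i = j
      · subst hi; simp [hs]
      · rw [hcon i hi]; simp [Ne.symm hi, Finsupp.single_apply]
    obtain ⟨i, hij, hi⟩ := this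
    apply Finset.prod_eq_zero (Finsupp.mem_support_iff.2 hi)
    simp [hij, hi]
  · intro h
    exfalso; apply h
    simp [Finset.mem_finsuppAntidiag]

theorem dpow_pair (x y : ι) (hxy : x ≠ y) (t : K) (n : ℕ) :
    dpow (fun i => if i = y then (1 : K) else if i = x then t else 0) n
      = ∑ k ∈ Finset.range (n + 1),
        Finsupp.single (Finsupp.single x k + Finsupp.single y (n - k)) (t ^ k) := by
  unfold dpow
  symm
  apply Finset.sum_of_injOn (fun k => Finsupp.single x k + Finsupp.single y (n - k))
  · intro k _ l _ h
    have := DFunLike.congr_fun h x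
    simpa [hxy, hxy.symm, Finsupp.single_apply] using this
  · intro k hk
    simp only [Finset.coe_range, Set.mem_Iio] at hk
    simp only [Finset.mem_coe, Finset.mem_finsuppAntidiag]
    refine ⟨?_, Finset.subset_univ _⟩
    simp [Finset.sum_add_distrib, Finsupp.single_apply, -Finsupp.single_tsub]
    omega
  · intro c hc hne
    rw [Finsupp.single_eq_zero]
    have : ∃ i, i ≠ x ∧ i ≠ y ∧ c i ≠ 0 := by
      by_contra hcon
      push Not at hcon
      apply hne
      have hs := (Finset.mem_finsuppAntidiag.1 hc).1
      have h2 : ∑ i, c i = c x + c y := by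
        rw [← Finset.sum_pair hxy]
        symm
        apply Finset.sum_subset (Finset.subset_univ _)
        intro i _ hi
        simp at hi
        exact hcon i hi.1 hi.2
      rw [h2] at hs
      refine ⟨c x, by simp; omega, ?_⟩
      ext i
      by_cases hi : i = x
      · subst hi; simp [hxy]
      · by_cases hi' : i = y
        · subst hi'; simp [hxy, hxy.symm, Finsupp.single_apply]; omega
        · rw [hcon i hi hi']; simp [Ne.symm hi, Ne.symm hi', Finsupp.single_apply]
    obtain ⟨i, hix, hiy, hi⟩ := this
    apply Finset.prod_eq_zero (Finsupp.mem_support_iff.2 hi)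
    simp [hix, hiy, hi]
  · intro k _
    congr 1
    rw [Finsupp.prod_add_index' (by simp) (by intros; rw [pow_add])]
    simp [hxy, -Finsupp.single_tsub]

theorem foldr_perm (σ : ι ≃ ι) (a : ι →₀ ℕ) (l : List ι) (hl : l.Nodup)
    (g : Matrix ι ι K) (hg : ∀ i ∈ l, (fun j => g j i) = fun j => if j = σ i then (1 : K) else 0) :
    (l.map fun i => dpow (fun j => g j i) (a i)).foldr
      (fun p q => dpMul K ι p q) (Finsupp.single 0 1)
      = Finsupp.single ((l.map fun i => Finsupp.single (σ i) (a i)).sum) 1 := by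
  induction l with
  | nil => simp
  | cons i l ih =>
    rw [List.nodup_cons] at hl
    simp only [List.map_cons, List.foldr_cons, List.sum_cons]
    rw [ih hl.2 (fun j hj => hg j (List.mem_cons_of_mem _ hj)), hg i List.mem_cons_self,
      dpow_single, dpMul_single, dpCoef_disj]
    · simp
    · intro j
      by_cases hj : σ i = j
      · right
        have : ∀ l : List ι, i ∉ l → (l.map fun i => Finsupp.single (σ i) (a i)).sum j = 0 := by
          intro l
          induction l with
          | nil => simp
          | cons k l ih =>
            intro h
            simp only [List.mem_cons, not_or] at h
            simp only [List.map_cons, List.sum_cons, Finsupp.add_apply, ih h.2, add_zero]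
            rw [Finsupp.single_apply, if_neg]
            rw [← hj]
            exact fun e => h.1 (σ.injective e).symm
        exact this l hl.1
      · left; simp [Finsupp.single_apply, hj]

theorem act_single (g : Matrix ι ι K) (a : ι →₀ ℕ) (c : K) :
    act g (Finsupp.single a c) = c • actMon g a := by
  simp [act, LinearMap.toSpanSingleton_apply]

theorem act_perm (g : Matrix ι ι K) (σ : ι ≃ ι)
    (hg : ∀ j i, g j i = if j = σ i then (1 : K) else 0) (a : ι →₀ ℕ) (c : K) :
    act g (Finsupp.single a c)
      = Finsupp.single (a.mapDomain σ) c := by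
  rw [act_single]
  unfold actMon
  rw [foldr_perm σ a _ (Finset.nodup_toList _) _ (fun i _ => funext fun j => hg j i)]
  rw [Finset.sum_map_toList]
  simp [Finsupp.mapDomain, Finsupp.sum]

theorem act_trans (g : Matrix ι ι K) (x y : ι) (hxy : x ≠ y) (t : K)
    (hg : ∀ j i, g j i = if j = i then (1 : K) else if i = y ∧ j = x then t else 0)
    (a : ι →₀ ℕ) (c : K) :
    act g
      (Finsupp.single a c)
      = ∑ k ∈ Finset.range (a y + 1),
        Finsupp.single (Finsupp.single x k + Finsupp.single y (a y - k) + a.erase y)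
          (c * t ^ k * (Nat.choose (k + a x) k : K)) := by
  rw [act_single]
  unfold actMon
  by_cases hy : a y = 0
  · rw [foldr_perm (Equiv.refl ι) a _ (Finset.nodup_toList _)]
    · rw [Finset.sum_map_toList, hy]
      have : a.erase y = a := Finsupp.erase_of_notMem_support (by simpa using hy)
      have h2 := Finsupp.sum_single a
      rw [Finsupp.sum] at h2
      simp [this, h2, -Finsupp.single_mul]
    · intro i hi
      have : i ≠ y := by rintro rfl; simp [hy] at hi
      ext j; by_cases hj : j = i <;> simp [hg, this, hj]
  · have hp : a.support.toList.Perm (y :: (a.support.erase y).toList) := by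
      rw [List.perm_ext_iff_of_nodup (Finset.nodup_toList _)]
      · intro i
        simp
        by_cases h : i = y
        · subst h; simpa using hy
        · simp [h]
      · simp [Finset.nodup_toList]
    rw [(hp.map _).foldr_eq]
    simp only [List.map_cons, List.foldr_cons]
    rw [foldr_perm (Equiv.refl ι) a _ (Finset.nodup_toList _)]
    · rw [Finset.sum_map_toList]
      have e1 : (fun j => g j y)
        = fun j => if j = y then (1 : K) else if j = x then t else 0 := by simp [hg]
      rw [e1, dpow_pair x y hxy]
      have e2 : ∑ i ∈ a.support.erase y, Finsupp.single ((Equiv.refl ι) i) (a i) = a.erase y := by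
        conv_rhs => rw [← Finsupp.sum_single (a.erase y)]
        rw [Finsupp.sum, Finsupp.support_erase]
        apply Finset.sum_congr rfl
        intro i hi
        simp at hi
        simp [hi.1]
      rw [e2]
      simp only [map_sum, LinearMap.sum_apply, dpMul_single, Finset.smul_sum, Finsupp.smul_single,
        smul_eq_mul]
      apply Finset.sum_congr rfl
      intro k _
      congr 1
      rw [dpCoef_eq, Finset.prod_eq_single x]
      · simp [hxy, Finsupp.single_apply, hxy.symm, mul_assoc]
      · intro i _ hi
        by_cases h : i = y
        · subst h; simp
        · simp [h, Finsupp.single_apply, Ne.symm h, Ne.symm hi]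
      · simp
    · intro i hi
      have : i ≠ y := by rintro rfl; simp at hi
      ext j; by_cases hj : j = i <;> simp [hg, this, hj]

theorem mem_Dsub (k : ℕ) (z : DPA K ι) :
    z ∈ Dsub K ι k ↔ ∀ a, z a ≠ 0 → deg a = k := by
  have : Dsub K ι k = Finsupp.supported K K {a | deg a = k} := by
    rw [Finsupp.supported_eq_span_single]
    unfold Dsub
    congr 1
    ext f
    simp [eq_comm]
  rw [this, Finsupp.mem_supported]
  simp [Set.subset_def]

theorem deg_eq (a : ι →₀ ℕ) : deg a = ∑ i, a i := by
  unfold deg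
  exact Finsupp.sum_fintype _ _ (by simp)

end general
/-! ## The differential and its homotopies -/

section homology

variable {K : Type} [Field K] {m : ℕ}

/-- Mixed parity at `i`. -/
def MixAt (i : Fin m) (a : (Fin m × Bool) →₀ ℕ) : Prop :=
  Odd (a (i, false) + a (i, true))

theorem xyIdx_apply (i : Fin m) (p : Fin m × Bool) : xyIdx m i p = if i = p.1 then 1 else 0 := by
  obtain ⟨j, b⟩ := p
  cases b <;> simp [xyIdx, Finsupp.single_apply]

theorem dpCoef_xy (i : Fin m) (a : (Fin m × Bool) →₀ ℕ) :
    dpCoef (xyIdx m i) a = (a (i, false) + 1) * (a (i, true) + 1) := by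
  rw [dpCoef_eq, Fintype.prod_prod_type, Finset.prod_eq_single i]
  · simp [xyIdx_apply, add_comm, mul_comm]
  · intro j _ hj
    simp [xyIdx_apply, Ne.symm hj]
  · simp

theorem del_single (a : (Fin m × Bool) →₀ ℕ) (c : K) :
    del K m (Finsupp.single a c)
      = ∑ i, Finsupp.single (xyIdx m i + a)
          (c * (((a (i, false) + 1) * (a (i, true) + 1) : ℕ) : K)) := by
  unfold del omegaDP
  simp only [map_sum, LinearMap.sum_apply, dpMul_single, dpCoef_xy, one_mul]

open Classical in
/-- The homotopy `h_i`. -/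
def hmt (K : Type) [Field K] {m : ℕ} (i : Fin m) :
    DPA K (Fin m × Bool) →ₗ[K] DPA K (Fin m × Bool) :=
  Finsupp.lsum K fun a => LinearMap.toSpanSingleton K _
    (if Odd (a (i, false)) ∧ Odd (a (i, true)) then Finsupp.single (a - xyIdx m i) (1 : K) else 0)

open Classical in
theorem hmt_single (i : Fin m) (a : (Fin m × Bool) →₀ ℕ) (c : K) :
    hmt K i (Finsupp.single a c) = if Odd (a (i, false)) ∧ Odd (a (i, true)) then
      Finsupp.single (a - xyIdx m i) c else 0 := by
  simp only [hmt, Finsupp.lsum_single, LinearMap.toSpanSingleton_apply]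
  split_ifs <;> simp

open Classical in
/-- The projection to monomials of mixed parity at `i`. -/
def qmix (K : Type) [Field K] {m : ℕ} (i : Fin m) :
    DPA K (Fin m × Bool) →ₗ[K] DPA K (Fin m × Bool) :=
  Finsupp.lsum K fun a => LinearMap.toSpanSingleton K _
    (if MixAt i a then Finsupp.single a (1 : K) else 0)

open Classical in
theorem qmix_single (i : Fin m) (a : (Fin m × Bool) →₀ ℕ) (c : K) :
    qmix K i (Finsupp.single a c) = if MixAt i a then Finsupp.single a c else 0 := by
  simp only [qmix, Finsupp.lsum_single, LinearMap.toSpanSingleton_apply]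
  split_ifs <;> simp

open Classical in
theorem qmix_apply (i : Fin m) (z : DPA K (Fin m × Bool)) (a : (Fin m × Bool) →₀ ℕ) :
    qmix K i z a = if MixAt i a then z a else 0 := by
  induction z using Finsupp.induction_linear with
  | zero => simp
  | add f g hf hg => rw [map_add, Finsupp.add_apply, hf, hg]; split_ifs <;> simp
  | single b c =>
    rw [qmix_single]
    by_cases h : b = a
    · subst h; split_ifs <;> simp
    · split_ifs <;> simp [Finsupp.single_apply, h]

theorem mixAt_add (i j : Fin m) (a : (Fin m × Bool) →₀ ℕ) :
    MixAt i (xyIdx m j + a) ↔ MixAt i a := by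
  unfold MixAt
  simp only [Finsupp.add_apply, xyIdx_apply, Nat.odd_iff]
  split_ifs <;> omega

theorem del_qmix (i : Fin m) (z : DPA K (Fin m × Bool)) :
    del K m (qmix K i z) = qmix K i (del K m z) := by
  classical
  induction z using Finsupp.induction_linear with
  | zero => simp
  | add f g hf hg => simp only [map_add, hf, hg]
  | single b c =>
    rw [qmix_single, del_single]
    simp only [map_sum, qmix_single, mixAt_add]
    split_ifs with h
    · rw [del_single]
    · simp

theorem homotopy [CharP K 2] (i : Fin m) (z : DPA K (Fin m × Bool)) :
    del K m (hmt K i z) + hmt K i (del K m z) = z - qmix K i z := by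
  classical
  have h2 : (2 : K) = 0 := CharTwo.two_eq_zero
  induction z using Finsupp.induction_linear with
  | zero => simp
  | add f g hf hg =>
    simp only [map_add]
    rw [add_sub_add_comm, ← hf, ← hg]; abel
  | single a c =>
    rw [qmix_single, hmt_single, del_single]
    simp only [map_sum, hmt_single]
    rw [Fintype.sum_eq_add_sum_compl i]
    by_cases ho : Odd (a (i, false)) ∧ Odd (a (i, true))
    · obtain ⟨h0, h1⟩ := ho
      have hm : ¬ MixAt i a := by unfold MixAt; rw [Nat.not_odd_iff_even]; exact h0.add_odd h1
      rw [if_pos ⟨h0, h1⟩, if_neg hm, del_single, Fintype.sum_eq_add_sum_compl i, if_neg]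
      · have e1 : xyIdx m i + (a - xyIdx m i) = a := by
          ext ⟨j, b⟩
          simp only [Finsupp.add_apply, Finsupp.tsub_apply, xyIdx_apply]
          split_ifs with h
          · subst h
            rw [Nat.odd_iff] at h0 h1
            cases b <;> omega
          · omega
        have e2 : ((((a - xyIdx m i) (i, false) + 1) * ((a - xyIdx m i) (i, true) + 1) : ℕ) : K)
            = 1 := by
          have : Odd (((a - xyIdx m i) (i, false) + 1) * ((a - xyIdx m i) (i, true) + 1)) := by
            simp only [Finsupp.tsub_apply, xyIdx_apply, if_true]
            rw [Nat.sub_add_cancel h0.pos, Nat.sub_add_cancel h1.pos]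
            exact h0.mul h1
          obtain ⟨k, hk⟩ := this
          rw [hk]; push_cast; rw [h2]; ring
        rw [e1, e2, mul_one, zero_add, sub_zero, add_assoc, add_eq_left, ← Finset.sum_add_distrib]
        apply Finset.sum_eq_zero
        intro j hj
        have hj : j ≠ i := by simpa using hj
        rw [if_pos]
        · have e3 : xyIdx m j + a - xyIdx m i = xyIdx m j + (a - xyIdx m i) := by
            ext ⟨k, b⟩
            simp only [Finsupp.add_apply, Finsupp.tsub_apply, xyIdx_apply]
            by_cases hk : i = k
            · subst hk
              simp [hj]
            · simp [hk]
          rw [e3, ← Finsupp.single_add]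
          simp only [Finsupp.tsub_apply, xyIdx_apply, Ne.symm hj, if_false, Nat.sub_zero]
          rw [CharTwo.add_self_eq_zero, Finsupp.single_zero]
        · simpa [xyIdx_apply, hj] using ⟨h0, h1⟩
      · simp only [Finsupp.add_apply, xyIdx_apply, if_true, Nat.odd_iff]
        rw [Nat.odd_iff] at h0 h1
        omega
    · rw [if_neg ho, map_zero, zero_add]
      rw [Finset.sum_eq_zero, add_zero]
      · by_cases hm : MixAt i a
        · rw [if_pos hm, if_neg, sub_self]
          unfold MixAt at hm
          simp only [Finsupp.add_apply, xyIdx_apply, if_true, Nat.odd_iff] at hm ⊢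
          omega
        · rw [if_neg hm]
          have hE : a (i, false) % 2 = 0 ∧ a (i, true) % 2 = 0 := by
            unfold MixAt at hm
            simp only [Nat.odd_iff] at hm ho
            omega
          rw [if_pos]
          · have : Odd ((a (i, false) + 1) * (a (i, true) + 1)) := by
              apply Odd.mul <;> rw [Nat.odd_iff] <;> omega
            obtain ⟨k, hk⟩ := this
            rw [hk, add_tsub_cancel_left]; push_cast; rw [h2]; simp
          · simp only [Finsupp.add_apply, xyIdx_apply, if_true, Nat.odd_iff]
            omega
      · intro j hj
        have hj : j ≠ i := by simpa using hj
        rw [if_neg]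
        simpa [xyIdx_apply, hj] using ho

theorem hmt_mem (i : Fin m) (k : ℕ) (z : DPA K (Fin m × Bool))
    (hz : z ∈ Dsub K (Fin m × Bool) (k + 2)) : hmt K i z ∈ Dsub K (Fin m × Bool) k := by
  classical
  unfold Dsub at hz
  induction hz using Submodule.span_induction with
  | zero => simp
  | add x y _ _ hx hy => rw [map_add]; exact Submodule.add_mem _ hx hy
  | smul c x _ hx => rw [map_smul]; exact Submodule.smul_mem _ _ hx
  | mem x hx =>
    obtain ⟨a, ha, rfl⟩ := hx
    rw [hmt_single]
    split_ifs with h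
    · apply Submodule.subset_span
      refine ⟨_, ?_, rfl⟩
      obtain ⟨h0, h1⟩ := h
      have e1 : xyIdx m i + (a - xyIdx m i) = a := by
          ext ⟨j, b⟩
          simp only [Finsupp.add_apply, Finsupp.tsub_apply, xyIdx_apply]
          split_ifs with h
          · subst h
            rw [Nat.odd_iff] at h0 h1
            cases b <;> omega
          · omega
      have e2 : deg a = 2 + deg (a - xyIdx m i) := by
        conv_lhs => rw [← e1]
        rw [deg_eq, deg_eq]
        simp only [Finsupp.add_apply, Finset.sum_add_distrib]
        congr 1
        simp only [xyIdx_apply, Fintype.sum_prod_type, Fintype.sum_bool, ← two_mul,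
          ← Finset.mul_sum, Finset.sum_ite_eq, Finset.mem_univ, if_true, mul_one]
      omega
    · simp

theorem reduce_mixed [CharP K 2] (k : ℕ) (z : DPA K (Fin m × Bool)) (hz : z ∈ Zmod K m (k + 2))
    (T : Finset (Fin m)) : ∃ z' ∈ Zmod K m (k + 2), z - z' ∈ Bful K m (k + 2) ∧
      ∀ a, z' a ≠ 0 → ∀ i ∈ T, MixAt i a := by
  classical
  induction T using Finset.induction_on with
  | empty => exact ⟨z, hz, by simp, by simp⟩
  | insert i T hi ih =>
    obtain ⟨z', hz', hB, hT⟩ := ih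
    refine ⟨qmix K i z', ⟨?_, ?_⟩, ?_, ?_⟩
    · have := hz'.1
      simp only [SetLike.mem_coe, LinearMap.mem_ker] at this ⊢
      rw [del_qmix, this, map_zero]
    · have := hz'.2
      simp only [SetLike.mem_coe, mem_Dsub] at this ⊢
      intro a ha
      apply this
      rw [qmix_apply] at ha
      intro h; simp [h] at ha
    · have h1 := homotopy i z'
      have := hz'.1
      simp only [SetLike.mem_coe, LinearMap.mem_ker] at this
      rw [this, map_zero, add_zero] at h1
      have : z - qmix K i z' = (z - z') + (z' - qmix K i z') := by abel
      rw [this, ← h1]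
      apply Submodule.add_mem _ hB
      exact Submodule.mem_map_of_mem (hmt_mem i k z' hz'.2)
    · intro a ha j hj
      rw [qmix_apply] at ha
      split_ifs at ha with h
      · rcases Finset.mem_insert.1 hj with rfl | hj
        · exact h
        · exact hT a ha j hj
      · simp at ha

/-- The coefficients of a coboundary at mixed monomials vanish. -/
theorem del_coef_mixed [CharP K 2] (z : DPA K (Fin m × Bool)) (b : (Fin m × Bool) →₀ ℕ)
    (hb : ∀ i, MixAt i b) : del K m z b = 0 := by
  induction z using Finsupp.induction_linear with
  | zero => simp
  | add f g hf hg => simp [hf, hg]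
  | single a c =>
    rw [del_single, Finsupp.finsetSum_apply]
    apply Finset.sum_eq_zero
    intro i _
    rw [Finsupp.single_apply]
    split_ifs with h
    · have : Even ((a (i, false) + 1) * (a (i, true) + 1)) := by
        have hh := (mixAt_add i i a).1 (by rw [h]; exact hb i)
        unfold MixAt at hh
        rw [Nat.even_mul, Nat.even_iff, Nat.even_iff]
        rw [Nat.odd_iff] at hh
        omega
      obtain ⟨k, hk⟩ := this
      rw [hk]; push_cast; rw [CharTwo.add_self_eq_zero, mul_zero]
    · rfl

theorem del_mixed [CharP K 2] (a : (Fin m × Bool) →₀ ℕ) (c : K)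
    (hb : ∀ i, MixAt i a) : del K m (Finsupp.single a c) = 0 := by
  rw [del_single]
  apply Finset.sum_eq_zero
  intro i _
  have : Even ((a (i, false) + 1) * (a (i, true) + 1)) := by
    have hh := hb i
    unfold MixAt at hh
    rw [Nat.even_mul, Nat.even_iff, Nat.even_iff]
    rw [Nat.odd_iff] at hh
    omega
  obtain ⟨k, hk⟩ := this
  rw [hk]; push_cast; rw [CharTwo.add_self_eq_zero, mul_zero, Finsupp.single_zero]

end homology
/-! ## The basis of the cohomology -/

section basis

variable {K : Type} [Field K] {m : ℕ}

/-- Labels of the basis of the cohomology: `(s, v)` stands for `e_s ⬝ v^{(2)}`. -/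
abbrev Lab (m : ℕ) : Type := (Fin m → Bool) × (Fin m × Bool)

/-- The multi-index of the label. -/
def lidx (q : Lab m) : (Fin m × Bool) →₀ ℕ :=
  Finsupp.equivFunOnFinite.symm fun p =>
    (if q.1 p.1 = p.2 then 1 else 0) + if p = q.2 then 2 else 0

theorem lidx_apply (q : Lab m) (p : Fin m × Bool) :
    lidx q p = (if q.1 p.1 = p.2 then 1 else 0) + if p = q.2 then 2 else 0 := rfl

theorem lidx_mix (q : Lab m) (i : Fin m) : MixAt i (lidx q) := by
  unfold MixAt
  rw [lidx_apply, lidx_apply, Nat.odd_iff]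
  cases q.1 i <;> simp <;> split_ifs <;> omega

theorem lidx_deg (q : Lab m) : deg (lidx q) = m + 2 := by
  rw [deg_eq]
  simp only [lidx_apply, Finset.sum_add_distrib]
  simp only [Finset.sum_ite_eq', Finset.mem_univ, if_true, Nat.add_right_cancel_iff]
  rw [Fintype.sum_prod_type, Finset.sum_congr rfl (g := fun _ => 1)]
  · simp only [Finset.sum_const, Finset.card_univ, Fintype.card_fin, smul_eq_mul, mul_one]
  · intro i _
    cases q.1 i <;> simp

theorem lidx_inj : Function.Injective (lidx (m := m)) := by
  rintro ⟨s, v⟩ ⟨s', v'⟩ h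
  have h1 : s = s' := by
    funext i
    have := DFunLike.congr_fun h (i, true)
    simp only [lidx_apply] at this
    cases hs : s i <;> cases hs' : s' i <;> simp [hs, hs'] at this ⊢
    · split_ifs at this <;> omega
    · split_ifs at this <;> omega
  subst h1
  have := DFunLike.congr_fun h v
  simp only [lidx_apply] at this
  simp at this
  rw [this]

theorem exists_lab (a : (Fin m × Bool) →₀ ℕ) (hm : ∀ i, MixAt i a) (hd : deg a = m + 2) :
    ∃ q : Lab m, lidx q = a := by
  unfold MixAt at hm
  simp only [Nat.odd_iff] at hm
  have hd' : ∑ i : Fin m, (a (i, false) + a (i, true)) = m + 2 := by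
    rw [← hd, deg_eq, Fintype.sum_prod_type]
    simp [add_comm]
  have hv : ∃ v, 2 ≤ a v := by
    by_contra hcon
    push Not at hcon
    have : ∑ i : Fin m, (a (i, false) + a (i, true)) = ∑ i : Fin m, 1 := by
      apply Finset.sum_congr rfl
      intro i _
      have := hcon (i, false)
      have := hcon (i, true)
      have := hm i
      omega
    rw [hd'] at this
    simp at this
  obtain ⟨⟨i0, b0⟩, hv⟩ := hv
  have key : ∀ i, a (i, false) + a (i, true) = 1 + if i = i0 then 2 else 0 := by
    have hle : ∀ i ∈ Finset.univ, (1 + if i = i0 then 2 else 0) ≤ a (i, false) + a (i, true) := by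
      intro i _
      have := hm i
      split_ifs with h
      · subst h
        cases b0 <;> omega
      · omega
    have hsum : ∑ i : Fin m, (1 + if i = i0 then 2 else 0)
        = ∑ i : Fin m, (a (i, false) + a (i, true)) := by
      rw [hd', Finset.sum_add_distrib]; simp
    intro i
    exact ((Finset.sum_eq_sum_iff_of_le hle).1 hsum i (Finset.mem_univ i)).symm
  refine ⟨(fun i => decide (a (i, true) % 2 = 1), (i0, b0)), ?_⟩
  ext ⟨i, b⟩
  rw [lidx_apply]
  have hk := key i
  simp only [Prod.mk.injEq]
  by_cases hi : i = i0
  · subst hi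
    simp only [if_true] at hk
    by_cases h1 : a (i, true) % 2 = 1
    · cases b <;> cases b0 <;> simp [h1] <;> omega
    · cases b <;> cases b0 <;> simp [h1] <;> omega
  · simp only [hi, if_false] at hk
    by_cases h1 : a (i, true) % 2 = 1
    · cases b <;> simp [h1, hi] <;> omega
    · cases b <;> simp [h1, hi] <;> omega

/-- The inclusion of the span of the labelled monomials. -/
def Lmap (K : Type) [Field K] (m : ℕ) : (Lab m →₀ K) →ₗ[K] DPA K (Fin m × Bool) :=
  Finsupp.lmapDomain K K lidx

theorem Lmap_single (q : Lab m) (c : K) :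
    Lmap K m (Finsupp.single q c) = Finsupp.single (lidx q) c := by
  simp [Lmap]

theorem Lmap_mem [CharP K 2] (f : Lab m →₀ K) : Lmap K m f ∈ Zmod K m (m + 2) := by
  induction f using Finsupp.induction_linear with
  | zero => simp
  | add f g hf hg => rw [map_add]; exact Submodule.add_mem _ hf hg
  | single q c =>
    rw [Lmap_single]
    refine ⟨?_, ?_⟩
    · simp only [SetLike.mem_coe, LinearMap.mem_ker]
      exact del_mixed _ _ (lidx_mix q)
    · simp only [SetLike.mem_coe, mem_Dsub]
      intro a ha
      rw [Finsupp.single_apply] at ha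
      split_ifs at ha with h
      · rw [← h, lidx_deg]
      · simp at ha

/-- The map from the labelled span to cohomology. -/
def Lcls (K : Type) [Field K] [CharP K 2] (m : ℕ) : (Lab m →₀ K) →ₗ[K] Hcoh K m (m + 2) :=
  (toH K m (m + 2)).comp ((Lmap K m).codRestrict _ Lmap_mem)

theorem Lcls_apply [CharP K 2] (f : Lab m →₀ K) :
    Lcls K m f = toH K m (m + 2) ⟨Lmap K m f, Lmap_mem f⟩ := rfl

theorem toH_eq_iff (k : ℕ) (z w : ↥(Zmod K m k)) :
    toH K m k z = toH K m k w ↔ (z : DPA K (Fin m × Bool)) - w ∈ Bful K m k := by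
  rw [← Submodule.Quotient.eq, Subtype.ext_iff]
  rfl

theorem Lcls_surj [CharP K 2] : Function.Surjective (Lcls K m) := by
  rintro ⟨_, z, hz, rfl⟩
  obtain ⟨z', hz', hB, hT⟩ := reduce_mixed m z hz Finset.univ
  have : ∃ f, Lmap K m f = z' := by
    refine ⟨Finsupp.comapDomain lidx z' lidx_inj.injOn, ?_⟩
    apply Finsupp.mapDomain_comapDomain _ lidx_inj
    intro a ha
    simp only [Finset.mem_coe, Finsupp.mem_support_iff] at ha
    exact exists_lab a (fun i => hT a ha i (Finset.mem_univ i))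
      ((mem_Dsub _ _).1 hz'.2 a ha)
  obtain ⟨f, hf⟩ := this
  refine ⟨f, ?_⟩
  rw [Lcls_apply]
  have := (toH_eq_iff (m + 2) (⟨z, hz⟩ : ↥(Zmod K m (m + 2))) ⟨Lmap K m f, Lmap_mem f⟩).2
    (by
      show z - Lmap K m f ∈ _
      rw [hf]; exact hB)
  rw [← this]
  rfl

theorem Lcls_single_ne [CharP K 2] (q : Lab m) : Lcls K m (Finsupp.single q 1) ≠ 0 := by
  intro h
  rw [← map_zero (Lcls K m), Lcls_apply, Lcls_apply, toH_eq_iff] at h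
  simp only [map_zero, sub_zero, Lmap_single] at h
  obtain ⟨z, _, hz⟩ := h
  have := del_coef_mixed z (lidx q) (lidx_mix q)
  rw [hz] at this
  simp at this

/-! ## The group action on the basis -/

/-- Action of a pair-preserving permutation on labels. -/
def permLab (σ : Equiv.Perm (Fin m)) (β : Equiv.Perm Bool) (q : Lab m) : Lab m :=
  (fun i => β (q.1 (σ.symm i)), (σ q.2.1, β q.2.2))

theorem lidx_perm (σ : Equiv.Perm (Fin m)) (β : Equiv.Perm Bool) (q : Lab m) :
    (lidx q).mapDomain (Equiv.prodCongr σ β) = lidx (permLab σ β q) := by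
  ext p
  obtain ⟨p, rfl⟩ := (Equiv.prodCongr σ β).surjective p
  rw [Finsupp.mapDomain_apply (Equiv.injective _)]
  simp only [lidx_apply, permLab]
  obtain ⟨i, b⟩ := p
  obtain ⟨s, ⟨j, c⟩⟩ := q
  simp

/-- The permutation matrix. -/
def permMat (K : Type) [Field K] {m : ℕ} (σ : Equiv.Perm (Fin m)) (β : Equiv.Perm Bool) :
    Matrix (Fin m × Bool) (Fin m × Bool) K :=
  Matrix.of fun j i => if j = Equiv.prodCongr σ β i then 1 else 0

theorem permMat_symp (σ : Equiv.Perm (Fin m)) (β : Equiv.Perm Bool) :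
    IsSymplectic (permMat K σ β) := by
  unfold IsSymplectic
  ext p q
  simp only [Matrix.mul_apply, Matrix.transpose_apply, permMat, Matrix.of_apply, ite_mul, one_mul,
    zero_mul, mul_ite, mul_one, mul_zero]
  rw [Finset.sum_ite_eq' Finset.univ, if_pos (Finset.mem_univ _),
    Finset.sum_ite_eq' Finset.univ, if_pos (Finset.mem_univ _)]
  simp [Jmat]

theorem act_permMat (σ : Equiv.Perm (Fin m)) (β : Equiv.Perm Bool) (f : Lab m →₀ K) :
    act (permMat K σ β) (Lmap K m f) = Lmap K m (f.mapDomain (permLab σ β)) := by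
  induction f using Finsupp.induction_linear with
  | zero => simp
  | add f g hf hg => simp only [map_add, hf, hg, Finsupp.mapDomain_add]
  | single q c =>
    rw [Finsupp.mapDomain_single, Lmap_single, Lmap_single,
      act_perm (permMat K σ β) (Equiv.prodCongr σ β) (fun _ _ => rfl), lidx_perm]

/-- The transvection matrix. -/
def tvMat {K : Type} [Field K] {m : ℕ} (i : Fin m) (t : K) :
    Matrix (Fin m × Bool) (Fin m × Bool) K :=
  Matrix.of fun j k => if j = k then 1 else if k = (i, true) ∧ j = (i, false) then t else 0

theorem tvMat_symp [CharP K 2] (i : Fin m) (t : K) : IsSymplectic (tvMat i t) := by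
  have hM : tvMat i t = 1 + Matrix.single (i, false) (i, true) t := by
    ext j k
    simp only [tvMat, Matrix.of_apply, Matrix.add_apply, Matrix.one_apply, Matrix.single_apply]
    by_cases h : j = k
    · subst h
      simp
      rintro rfl; simp
    · simp [h, and_comm, eq_comm]
  unfold IsSymplectic
  rw [hM]
  simp only [Matrix.transpose_add, Matrix.transpose_one, Matrix.transpose_single, add_mul, mul_add,
    one_mul, mul_one]
  have e1 : Matrix.single (i, true) (i, false) t * Jmat K m
      = Matrix.single (i, true) (i, true) t := by
    ext j k
    by_cases hj : j = (i, true)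
    · subst hj
      simp only [Matrix.single_mul_apply_same, Jmat, Matrix.single_apply]
      obtain ⟨k, b⟩ := k
      cases b <;> simp
    · rw [Matrix.single_mul_apply_of_ne _ _ _ _ _ hj]
      simp [Matrix.single_apply, Ne.symm hj]
  have e2 : Jmat K m * Matrix.single (i, false) (i, true) t
      = Matrix.single (i, true) (i, true) t := by
    ext j k
    by_cases hk : k = (i, true)
    · subst hk
      simp only [Matrix.mul_single_apply_same, Jmat, Matrix.single_apply]
      obtain ⟨k, b⟩ := j
      cases b <;> simp [eq_comm]
    · rw [Matrix.mul_single_apply_of_ne _ _ _ _ _ hk]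
      simp [Matrix.single_apply, Ne.symm hk]
  rw [e1, e2, Matrix.single_mul_single_of_ne _ _ _ _ (by simp)]
  have : Matrix.single (i, true) (i, true) t + Matrix.single (i, true) (i, true) t
      = (0 : Matrix (Fin m × Bool) (Fin m × Bool) K) := by
    rw [← Matrix.single_add, CharTwo.add_self_eq_zero, Matrix.single_zero]
  rw [add_zero, add_assoc, this, add_zero]

/-- Change of the sign at `i`. -/
def opA (K : Type) [Field K] {m : ℕ} (i : Fin m) (b : Bool) : (Lab m →₀ K) →ₗ[K] (Lab m →₀ K) :=
  Finsupp.lsum K fun q => LinearMap.toSpanSingleton K _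
    (if q.1 i = b then Finsupp.single (Function.update q.1 i (!b), q.2) 1 else 0)

/-- Change of the doubled variable at `i`. -/
def opB (K : Type) [Field K] {m : ℕ} (i : Fin m) (b : Bool) : (Lab m →₀ K) →ₗ[K] (Lab m →₀ K) :=
  Finsupp.lsum K fun q => LinearMap.toSpanSingleton K _
    (if q.2 = (i, b) then Finsupp.single (q.1, (i, !b)) 1 else 0)

theorem opA_single (i : Fin m) (b : Bool) (q : Lab m) (c : K) :
    opA K i b (Finsupp.single q c)
      = if q.1 i = b then Finsupp.single (Function.update q.1 i (!b), q.2) c else 0 := by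
  simp only [opA, Finsupp.lsum_single, LinearMap.toSpanSingleton_apply]
  split_ifs <;> simp

theorem opB_single (i : Fin m) (b : Bool) (q : Lab m) (c : K) :
    opB K i b (Finsupp.single q c)
      = if q.2 = (i, b) then Finsupp.single (q.1, (i, !b)) c else 0 := by
  simp only [opB, Finsupp.lsum_single, LinearMap.toSpanSingleton_apply]
  split_ifs <;> simp

end basis
section final

variable {K : Type} [Field K] {m : ℕ}

theorem lidx_shift (q q' : Lab m) (i : Fin m) (k : ℕ)
    (hx : lidx q' (i, false) = k + lidx q (i, false))
    (hy : lidx q' (i, true) = lidx q (i, true) - k)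
    (ho : ∀ p, p.1 ≠ i → lidx q' p = lidx q p) :
    Finsupp.single (i, false) k + Finsupp.single (i, true) (lidx q (i, true) - k)
      + (lidx q).erase (i, true) = lidx q' := by
  ext ⟨j, b⟩
  by_cases hj : j = i
  · subst hj
    cases b
    · simp [hx, -Finsupp.single_tsub, Finsupp.single_apply, Finsupp.erase_apply]
    · simp [hy, -Finsupp.single_tsub, Finsupp.single_apply, Finsupp.erase_apply]
  · rw [ho (j, b) hj]
    simp [-Finsupp.single_tsub, Finsupp.single_apply, Finsupp.erase_apply, hj, Ne.symm hj]

theorem act_tvMat [CharP K 2] (i : Fin m) (t : K) (f : Lab m →₀ K) :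
    act (tvMat i t) (Lmap K m f) = Lmap K m (f + t • opA K i true f + t ^ 2 • opB K i true f
      + t ^ 3 • opA K i true (opB K i true f)) := by
  have h2 : (2 : K) = 0 := CharTwo.two_eq_zero
  have h3 : (3 : K) = 1 := by linear_combination h2
  induction f using Finsupp.induction_linear with
  | zero => simp
  | add f g hf hg =>
    simp only [map_add, hf, hg, smul_add]
    abel
  | single q c =>
    rw [Lmap_single, act_trans (tvMat i t) (i, false) (i, true) (by simp) t (fun _ _ => rfl)]
    have M0 := lidx_shift q q i 0 (by simp) (by simp) (fun _ _ => rfl)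
    have MA : q.1 i = true → _ := fun h => lidx_shift q (Function.update q.1 i false, q.2) i 1
      (by simp [lidx_apply, h]; try omega) (by simp [lidx_apply, h])
      (fun p hp => by simp [lidx_apply, hp])
    have MB : q.2 = (i, true) → _ := fun h => lidx_shift q (q.1, (i, false)) i 2
      (by simp [lidx_apply, h]; try omega) (by simp [lidx_apply, h])
      (fun p hp => by
        have h1 : p ≠ (i, true) := fun e => hp (by rw [e])
        have h2 : p ≠ (i, false) := fun e => hp (by rw [e])
        simp [lidx_apply, h, h1, h2])
    have MC : q.1 i = true → q.2 = (i, true) → _ :=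
      fun h' h => lidx_shift q (Function.update q.1 i false, (i, false)) i 3
      (by simp [lidx_apply, h, h']) (by simp [lidx_apply, h, h'])
      (fun p hp => by
        have h1 : p ≠ (i, true) := fun e => hp (by rw [e])
        have h2 : p ≠ (i, false) := fun e => hp (by rw [e])
        simp [lidx_apply, h, hp, h1, h2])
    rw [opB_single, opA_single]
    have hxv := lidx_apply q (i, false)
    have hyv := lidx_apply q (i, true)
    by_cases hs : q.1 i = true
    · have MA := MA hs
      by_cases hv : q.2 = (i, true)
      · have MB := MB hv
        have MC := MC hs hv
        simp [hs, hv] at hxv hyv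
        rw [hyv] at M0 MA MB MC ⊢
        simp only [Finset.sum_range_succ, Finset.sum_range_zero, hxv, M0, MA, MB, MC, zero_add,
          add_zero, Nat.choose_self, Nat.cast_one, mul_one, pow_zero, pow_one]
        simp only [hs, hv, if_true, opA_single, Bool.not_true, map_add, map_smul, Lmap_single,
          Finsupp.smul_single, smul_eq_mul]
        simp only [hv, mul_comm]
      · have hy1 : lidx q (i, true) = 1 := by
          rw [hyv]; simp [hs, Ne.symm hv]
        have hc : ((Nat.choose (1 + lidx q (i, false)) 1 : ℕ) : K) = 1 := by
          rw [hxv, if_neg (by simp [hs])]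
          by_cases h : (i, false) = q.2
          · rw [if_pos h]; norm_num; exact h3
          · rw [if_neg h]; norm_num
        rw [hy1] at M0 MA ⊢
        simp only [Finset.sum_range_succ, Finset.sum_range_zero, M0, MA, hc, zero_add,
          Nat.choose_zero_right, Nat.cast_one, mul_one, pow_zero, pow_one]
        simp only [hs, hv, if_true, if_false, Bool.not_true, map_add, map_smul, Lmap_single,
          Finsupp.smul_single, smul_eq_mul, map_zero, smul_zero, add_zero, mul_comm]
    · by_cases hv : q.2 = (i, true)
      · have MB := MB hv
        simp [hs, hv] at hxv hyv
        rw [hyv] at M0 MB ⊢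
        have hc : ((Nat.choose (2 + 1) 2 : ℕ) : K) = 1 := by
          rw [show Nat.choose (2 + 1) 2 = 3 from rfl]; exact_mod_cast h3
        have hc' : ((Nat.choose (1 + 1) 1 : ℕ) : K) = 0 := by
          rw [show Nat.choose (1 + 1) 1 = 2 from rfl]; exact_mod_cast h2
        simp only [Finset.sum_range_succ, Finset.sum_range_zero, hxv, M0, MB, hc, hc', zero_add,
          add_zero, Nat.choose_zero_right, Nat.cast_one, mul_one, pow_zero, pow_one, mul_zero]
        rw [Finsupp.single_zero]
        simp only [hs, hv, if_true, if_false, opA_single, Bool.not_true, map_add, map_smul,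
          Lmap_single, Finsupp.smul_single, smul_eq_mul, map_zero, smul_zero, add_zero, mul_comm]
        simp
      · have hy1 : lidx q (i, true) = 0 := by
          rw [hyv]; simp [hs, Ne.symm hv]
        rw [hy1] at M0 ⊢
        simp only [Finset.sum_range_succ, Finset.sum_range_zero, M0, zero_add,
          Nat.choose_zero_right, Nat.cast_one, mul_one, pow_zero, pow_one]
        simp [hs, hv, Lmap_single]

/-! ## Irreducibility -/

theorem opA_conj (i : Fin m) (f : Lab m →₀ K) :
    opA K i false f = (opA K i true (f.mapDomain (permLab (Equiv.refl _) Equiv.boolNot))).mapDomain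
      (permLab (Equiv.refl _) Equiv.boolNot) := by
  induction f using Finsupp.induction_linear with
  | zero => simp
  | add f g hf hg => simp only [map_add, hf, hg, Finsupp.mapDomain_add]
  | single q c =>
    rw [Finsupp.mapDomain_single, opA_single, opA_single]
    obtain ⟨s, ⟨j, b⟩⟩ := q
    cases h : s i
    · simp only [permLab, h, if_true]
      simp [h, Finsupp.mapDomain_single, permLab]
      congr 2
      ext k
      by_cases hk : k = i
      · subst hk; simp
      · simp [hk]
    · simp [permLab, h]

theorem opB_conj (i : Fin m) (f : Lab m →₀ K) :
    opB K i false f = (opB K i true (f.mapDomain (permLab (Equiv.refl _) Equiv.boolNot))).mapDomain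
      (permLab (Equiv.refl _) Equiv.boolNot) := by
  induction f using Finsupp.induction_linear with
  | zero => simp
  | add f g hf hg => simp only [map_add, hf, hg, Finsupp.mapDomain_add]
  | single q c =>
    rw [Finsupp.mapDomain_single, opB_single, opB_single]
    obtain ⟨s, ⟨j, b⟩⟩ := q
    cases b
    · by_cases hj : j = i
      · subst hj
        simp [permLab, Finsupp.mapDomain_single]
      · simp [permLab, hj]
    · simp [permLab]

theorem opA_opA (i : Fin m) (b : Bool) (f : Lab m →₀ K) :
    opA K i (!b) (opA K i b f) = f.filter (fun q => q.1 i = b) := by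
  induction f using Finsupp.induction_linear with
  | zero => rw [map_zero, map_zero, Finsupp.filter_zero]
  | add f g hf hg => simp only [map_add, hf, hg, Finsupp.filter_add]
  | single q c =>
    rw [opA_single]
    split_ifs with h
    · rw [opA_single, Finsupp.filter_single_of_pos (fun q : Lab m => q.1 i = b) h]
      simp [← h]
    · rw [Finsupp.filter_single_of_neg (fun q : Lab m => q.1 i = b) h, map_zero]

theorem opB_opB (i : Fin m) (b : Bool) (f : Lab m →₀ K) :
    opB K i (!b) (opB K i b f) = f.filter (fun q => q.2 = (i, b)) := by
  induction f using Finsupp.induction_linear with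
  | zero => rw [map_zero, map_zero, Finsupp.filter_zero]
  | add f g hf hg => simp only [map_add, hf, hg, Finsupp.filter_add]
  | single q c =>
    rw [opB_single]
    split_ifs with h
    · rw [opB_single, Finsupp.filter_single_of_pos (fun q : Lab m => q.2 = (i, b)) h]
      simp [← h]
    · rw [Finsupp.filter_single_of_neg (fun q : Lab m => q.2 = (i, b)) h, map_zero]

theorem irred_aux (U : Submodule K (Lab m →₀ K))
    (hA : ∀ i b, ∀ f ∈ U, opA K i b f ∈ U) (hB : ∀ i b, ∀ f ∈ U, opB K i b f ∈ U)
    (hP : ∀ σ, ∀ f ∈ U, f.mapDomain (permLab σ 1) ∈ U) (hU : U ≠ ⊥) : U = ⊤ := by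
  obtain ⟨f, hf, hne⟩ := Submodule.exists_mem_ne_zero_of_ne_bot hU
  obtain ⟨⟨s0, ⟨i0, b0⟩⟩, hq⟩ := Finsupp.ne_iff.1 hne
  simp only [Finsupp.coe_zero, Pi.zero_apply] at hq
  -- isolate the monomial
  have h1 : ∀ T : Finset (Fin m),
      f.filter (fun q => q.2 = (i0, b0) ∧ ∀ i ∈ T, q.1 i = s0 i) ∈ U := by
    intro T
    induction T using Finset.induction_on with
    | empty =>
      have := hB i0 (!b0) _ (hB i0 b0 f hf)
      rw [opB_opB] at this
      convert this using 2
      simp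
    | insert i T hi ih =>
      have := hA i (!(s0 i)) _ (hA i (s0 i) _ ih)
      rw [opA_opA] at this
      convert this using 1
      ext q
      simp only [Finsupp.filter_apply, Finset.mem_insert, forall_eq_or_imp]
      split_ifs <;> first | rfl | (exfalso; tauto)
  have h2 : Finsupp.single (s0, (i0, b0)) (1 : K) ∈ U := by
    have := U.smul_mem (f (s0, (i0, b0)))⁻¹ (h1 Finset.univ)
    convert this using 1
    ext ⟨s, v⟩
    simp only [Finsupp.single_apply, Finsupp.smul_apply, Finsupp.filter_apply, smul_eq_mul,
      Finset.mem_univ, true_imp_iff]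
    by_cases h : v = (i0, b0) ∧ ∀ i, s i = s0 i
    · have hs : s = s0 := funext h.2
      obtain ⟨rfl, -⟩ := h
      subst hs
      simp [hq]
    · rw [if_neg h, if_neg, mul_zero]
      intro e
      apply h
      simp only [Prod.mk.injEq] at e
      rw [← e.1]
      exact ⟨by rw [← e.2], fun _ => rfl⟩
  have h3 : ∀ s, Finsupp.single (s, (i0, b0)) (1 : K) ∈ U := by
    intro s
    have : ∀ T : Finset (Fin m), Finsupp.single (T.piecewise s s0, (i0, b0)) (1 : K) ∈ U := by
      intro T
      induction T using Finset.induction_on with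
      | empty => simpa using h2
      | insert i T hi ih =>
        rw [Finset.piecewise_insert]
        by_cases h : s i = s0 i
        · rw [h, ← Finset.piecewise_eq_of_notMem T s s0 hi, Function.update_eq_self]
          exact ih
        · have := hA i (s0 i) _ ih
          rw [opA_single, if_pos (by simp [hi])] at this
          have e : (!(s0 i)) = s i := by
            revert h; cases s i <;> cases s0 i <;> simp
          rw [e] at this
          exact this
    simpa using this Finset.univ
  have h4 : ∀ s b, Finsupp.single (s, (i0, b)) (1 : K) ∈ U := by
    intro s b
    by_cases h : b = b0
    · rw [h]; exact h3 s
    · have := hB i0 b0 _ (h3 s)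
      rw [opB_single, if_pos rfl] at this
      have e : (!b0) = b := by
        revert h; cases b <;> cases b0 <;> simp
      rwa [e] at this
  have h5 : ∀ q, Finsupp.single q (1 : K) ∈ U := by
    rintro ⟨s, ⟨j, b⟩⟩
    have := hP (Equiv.swap i0 j) _ (h4 (fun i => s (Equiv.swap i0 j i)) b)
    rw [Finsupp.mapDomain_single] at this
    simpa [permLab] using this
  rw [eq_top_iff]
  intro g _
  rw [← Finsupp.sum_single g]
  apply Submodule.sum_mem
  intro q _
  have := U.smul_mem (g q) (h5 q)
  simpa using this

theorem exists_cube_root (K : Type) [Field K] [IsAlgClosed K] : ∃ a : K, a ^ 2 + a + 1 = 0 := by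
  obtain ⟨a, ha⟩ := IsAlgClosed.exists_root
    (Polynomial.X ^ 2 + Polynomial.X + 1 : Polynomial K) (by
      have : (Polynomial.X ^ 2 + Polynomial.X + 1 : Polynomial K).degree = 2 := by compute_degree!
      rw [this]; norm_num)
  exact ⟨a, by simpa [Polynomial.IsRoot] using ha⟩

theorem extract {M : Type} [AddCommGroup M] [Module K M] [IsAlgClosed K] [CharP K 2]
    (U : Submodule K M) (w0 w1 w2 w3 : M) (h0 : w0 ∈ U)
    (h : ∀ t : K, w0 + t • w1 + t ^ 2 • w2 + t ^ 3 • w3 ∈ U) : w1 ∈ U ∧ w2 ∈ U := by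
  obtain ⟨a, ha⟩ := exists_cube_root K
  have c2 : (2 : K) = 0 := CharTwo.two_eq_zero
  have h' : ∀ t : K, t • w1 + t ^ 2 • w2 + t ^ 3 • w3 ∈ U := by
    intro t
    have := U.sub_mem (h t) h0
    convert this using 1
    abel
  have e1 : w1 = (1 : K) • ((1 : K) • w1 + (1 : K) ^ 2 • w2 + (1 : K) ^ 3 • w3)
      + a ^ 2 • (a • w1 + a ^ 2 • w2 + a ^ 3 • w3)
      + a • ((a ^ 2) • w1 + (a ^ 2) ^ 2 • w2 + (a ^ 2) ^ 3 • w3) := by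
    match_scalars
    · linear_combination (-2 * (a - 1)) * ha - c2
    · linear_combination (-(a ^ 3 - a + 1)) * ha + 0 * c2
    · linear_combination (-(a ^ 5 - a ^ 4 + a ^ 3 - a + 1)) * ha + 0 * c2
  have e2 : w2 = (1 : K) • ((1 : K) • w1 + (1 : K) ^ 2 • w2 + (1 : K) ^ 3 • w3)
      + a • (a • w1 + a ^ 2 • w2 + a ^ 3 • w3)
      + a ^ 2 • ((a ^ 2) • w1 + (a ^ 2) ^ 2 • w2 + (a ^ 2) ^ 3 • w3) := by
    match_scalars
    · linear_combination (-(a ^ 3 + 1 + 1) * (a - 1)) * ha - c2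
    · linear_combination (-(a ^ 2 - a + 1)) * ha + 0 * c2
    · linear_combination (-(a ^ 2 - a + 1) * (a ^ 4 - a ^ 2 + 1)) * ha + 0 * c2
  constructor
  · rw [e1]
    exact U.add_mem (U.add_mem (U.smul_mem _ (h' _)) (U.smul_mem _ (h' _))) (U.smul_mem _ (h' _))
  · rw [e2]
    exact U.add_mem (U.add_mem (U.smul_mem _ (h' _)) (U.smul_mem _ (h' _))) (U.smul_mem _ (h' _))

end final

/-- Over an algebraically closed field of characteristic 2,
`H^{m+2}(DV)` is an irreducible `Sp(V)`-module: it is nonzero and its only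
`Sp(V)`-invariant subspaces are `0` and the whole space. -/
theorem statement_14 (K : Type) [Field K] [IsAlgClosed K] [CharP K 2] (m : ℕ) (hm : 1 ≤ m) :
    Nontrivial (Hcoh K m (m + 2)) ∧
    ∀ W : Submodule K (Hcoh K m (m + 2)),
      (∀ g : Matrix (Fin m × Bool) (Fin m × Bool) K, IsSymplectic g →
        ∀ z w : ↥(Zmod K m (m + 2)), (w : DPA K (Fin m × Bool)) = act g ↑z →
          toH K m (m + 2) z ∈ W → toH K m (m + 2) w ∈ W) →
      W = ⊥ ∨ W = ⊤ := by
  refine ⟨⟨Lcls K m (Finsupp.single (fun _ => true, (⟨0, hm⟩, true)) 1), 0, Lcls_single_ne _⟩, ?_⟩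
  intro W hW
  by_cases hbot : W = ⊥
  · exact Or.inl hbot
  right
  have inv : ∀ g : Matrix (Fin m × Bool) (Fin m × Bool) K, IsSymplectic g →
      ∀ f f' : Lab m →₀ K, act g (Lmap K m f) = Lmap K m f' →
        f ∈ W.comap (Lcls K m) → f' ∈ W.comap (Lcls K m) := by
    intro g hg f f' hff hf
    exact hW g hg ⟨Lmap K m f, Lmap_mem f⟩ ⟨Lmap K m f', Lmap_mem f'⟩ hff.symm hf
  have hP : ∀ σ β, ∀ f ∈ W.comap (Lcls K m), f.mapDomain (permLab σ β) ∈ W.comap (Lcls K m) :=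
    fun σ β f hf => inv _ (permMat_symp σ β) f _ (act_permMat σ β f) hf
  have hE : ∀ i, ∀ f ∈ W.comap (Lcls K m), opA K i true f ∈ W.comap (Lcls K m) ∧
      opB K i true f ∈ W.comap (Lcls K m) := fun i f hf =>
    extract _ f _ _ (opA K i true (opB K i true f)) hf
      fun t => inv _ (tvMat_symp i t) f _ (act_tvMat i t f) hf
  have htop : W.comap (Lcls K m) = ⊤ := by
    apply irred_aux
    · intro i b f hf
      cases b
      · rw [opA_conj]
        exact hP _ _ _ (hE i _ (hP _ _ _ hf)).1
      · exact (hE i f hf).1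
    · intro i b f hf
      cases b
      · rw [opB_conj]
        exact hP _ _ _ (hE i _ (hP _ _ _ hf)).2
      · exact (hE i f hf).2
    · exact fun σ f hf => hP σ 1 f hf
    · intro h
      apply hbot
      rw [eq_bot_iff]
      intro w hw
      obtain ⟨f, rfl⟩ := Lcls_surj w
      have : f ∈ W.comap (Lcls K m) := hw
      rw [h, Submodule.mem_bot] at this
      rw [this, map_zero]
      exact Submodule.zero_mem _
  rw [eq_top_iff]
  intro w _
  obtain ⟨f, rfl⟩ := Lcls_surj w
  have : f ∈ W.comap (Lcls K m) := by rw [htop]; trivial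
  exact this
end
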